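/- Let ω ∈ ℂ with ω² + ω + 1 = 0, and let c be a nonempty list of integers with every entry ≥ 2. Then: (1) 𝓢(c)(ω) = 0 if s(c) ≡ 0 (mod 3); 𝓢(c)(ω) ∈ {1, ω, ω²} if s(c) ≡ 1 (mod 3); 𝓢(c)(ω) ∈ {−1, −ω, −ω²} if s(c) ≡ 2 (mod 3); in particular the polynomial [3]_q = 1 + q + q² divides 𝓢(c) in ℤ[q] if and only if 3 divides s(c). (2) Analogously, 𝓡(c)(ω) = 0 if r(c) ≡ 0 (mod 3); 𝓡(c)(ω) ∈ {1, ω, ω²} if r(c) ≡ 1 (mod 3); 𝓡(c)(ω) ∈ {−1, −ω, −ω²} if r(c) ≡ 2 (mod 3). -/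

import Mathlib

open Polynomial

/-- The `q`-deformation `[n]_q = 1 + q + ⋯ + q^{n-1}` of a nonnegative integer. -/
noncomputable def qNat (n : ℕ) : Polynomial ℤ := (Finset.range n).sum fun i => X ^ i

/-- The matrix `M_q⁻(c) = (([c]_q, -q^{c-1}), (1, 0))` over `ℤ[q]`. -/
noncomputable def MqNeg (c : ℕ) : Matrix (Fin 2) (Fin 2) (Polynomial ℤ) :=
  !![qNat c, -(X ^ (c - 1)); 1, 0]

/-- `𝓡(c)`: the (0,0) entry of `M_q⁻(c₁)⋯M_q⁻(c_l)`. -/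
noncomputable def Rpoly (L : List ℕ) : Polynomial ℤ := ((L.map MqNeg).prod) 0 0

/-- `𝓢(c)`: the (1,0) entry of `M_q⁻(c₁)⋯M_q⁻(c_l)`. -/
noncomputable def Spoly (L : List ℕ) : Polynomial ℤ := ((L.map MqNeg).prod) 1 0

/-- `r(c) = 𝓡(c)(1)`. -/
noncomputable def rNum (L : List ℕ) : ℤ := (Rpoly L).eval 1

/-- `s(c) = 𝓢(c)(1)`. -/
noncomputable def sNum (L : List ℕ) : ℤ := (Spoly L).eval 1

/-- `u` is plus or minus a power of `ω` (a cube root of unity), and `e` is its sign modulo 3. -/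
def IsSignedPow (ω u : ℂ) (e : ZMod 3) : Prop :=
  (e = 1 ∧ (u = 1 ∨ u = ω ∨ u = ω ^ 2)) ∨ (e = -1 ∧ (u = -1 ∨ u = -ω ∨ u = -ω ^ 2))

theorem IsSignedPow.neg {ω u : ℂ} {e : ZMod 3} (h : IsSignedPow ω u e) :
    IsSignedPow ω (-u) (-e) := by
  rcases h with ⟨rfl, rfl | rfl | rfl⟩ | ⟨rfl, rfl | rfl | rfl⟩ <;> simp [IsSignedPow]

theorem IsSignedPow.mul_root {ω u : ℂ} {e : ZMod 3} (hω : ω ^ 3 = 1) (h : IsSignedPow ω u e) :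
    IsSignedPow ω (ω * u) e := by
  have h2 : ω * ω ^ 2 = 1 := by rw [← hω]; ring
  have h1 : ω * ω = ω ^ 2 := by ring
  rcases h with ⟨rfl, rfl | rfl | rfl⟩ | ⟨rfl, rfl | rfl | rfl⟩ <;>
    simp [IsSignedPow, h1, h2]

/-- The possible pairs of values `(R, S)` at `ω`, together with the residues `(r, s)` modulo 3
of the values at `1`: up to a common signed power of `ω`, one for each point of `ℙ¹(𝔽₃)`. -/
def IsValuePair (ω R S : ℂ) (r s : ZMod 3) : Prop :=
  ∃ u e, IsSignedPow ω u e ∧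
    ((R = u ∧ S = 0 ∧ r = e ∧ s = 0) ∨ (R = 0 ∧ S = u ∧ r = 0 ∧ s = e) ∨
      (R = u ∧ S = u ∧ r = e ∧ s = e) ∨ (R = -(ω * (ω * u)) ∧ S = u ∧ r = -e ∧ s = e))

theorem pow_three_eq_one_of_root {ω : ℂ} (hω : ω ^ 2 + ω + 1 = 0) : ω ^ 3 = 1 := by
  linear_combination (ω - 1) * hω

theorem IsValuePair.step_zero {ω R S : ℂ} {r s : ZMod 3} (hω : ω ^ 2 + ω + 1 = 0)
    (h : IsValuePair ω R S r s) : IsValuePair ω (-(ω ^ 2 * S)) R (-s) r := by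
  have h3 := pow_three_eq_one_of_root hω
  obtain ⟨u, e, hu, ⟨rfl, rfl, rfl, rfl⟩ | ⟨rfl, rfl, rfl, rfl⟩ | ⟨rfl, rfl, rfl, rfl⟩ |
    ⟨rfl, rfl, rfl, rfl⟩⟩ := h
  · exact ⟨_, _, hu, .inr (.inl (by simp))⟩
  · exact ⟨_, _, ((hu.mul_root h3).mul_root h3).neg, .inl ⟨by ring, rfl, rfl, rfl⟩⟩
  · exact ⟨_, _, hu, .inr (.inr (.inr ⟨by ring, rfl, rfl, rfl⟩))⟩
  · exact ⟨_, _, ((hu.mul_root h3).mul_root h3).neg,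
      .inr (.inr (.inl ⟨by ring, rfl, rfl, rfl⟩))⟩

theorem IsValuePair.step_one {ω R S : ℂ} {r s : ZMod 3} (hω : ω ^ 2 + ω + 1 = 0)
    (h : IsValuePair ω R S r s) : IsValuePair ω (R - S) R (r - s) r := by
  have h3 := pow_three_eq_one_of_root hω
  obtain ⟨u, e, hu, ⟨rfl, rfl, rfl, rfl⟩ | ⟨rfl, rfl, rfl, rfl⟩ | ⟨rfl, rfl, rfl, rfl⟩ |
    ⟨rfl, rfl, rfl, rfl⟩⟩ := h
  · exact ⟨_, _, hu, .inr (.inr (.inl (by simp)))⟩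
  · exact ⟨_, _, hu.neg, .inl (by simp)⟩
  · exact ⟨_, _, hu, .inr (.inl (by simp))⟩
  · refine ⟨_, _, ((hu.mul_root h3).mul_root h3).neg, .inr (.inr (.inr ⟨?_, rfl, ?_, rfl⟩))⟩
    · linear_combination (-S) * hω - ω * S * h3
    · clear hu; decide +revert

theorem IsValuePair.step_two {ω R S : ℂ} {r s : ZMod 3} (hω : ω ^ 2 + ω + 1 = 0)
    (h : IsValuePair ω R S r s) :
    IsValuePair ω ((1 + ω) * R - ω * S) R (2 * r - s) r := by
  have h3 := pow_three_eq_one_of_root hω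
  obtain ⟨u, e, hu, ⟨rfl, rfl, rfl, rfl⟩ | ⟨rfl, rfl, rfl, rfl⟩ | ⟨rfl, rfl, rfl, rfl⟩ |
    ⟨rfl, rfl, rfl, rfl⟩⟩ := h
  · refine ⟨_, _, hu, .inr (.inr (.inr ⟨?_, rfl, ?_, rfl⟩))⟩
    · linear_combination R * hω
    · clear hu; decide +revert
  · exact ⟨_, _, (hu.mul_root h3).neg, .inl ⟨by ring, rfl, by ring, rfl⟩⟩
  · exact ⟨_, _, hu, .inr (.inr (.inl ⟨by ring, rfl, by ring, rfl⟩))⟩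
  · refine ⟨_, _, ((hu.mul_root h3).mul_root h3).neg, .inr (.inl ⟨?_, rfl, ?_, rfl⟩)⟩
    · linear_combination (-ω * S) * hω
    · clear hu; decide +revert

theorem Rpoly_cons (c : ℕ) (L : List ℕ) :
    Rpoly (c :: L) = qNat c * Rpoly L - X ^ (c - 1) * Spoly L := by
  simp [Rpoly, Spoly, MqNeg, Matrix.mul_apply, Fin.sum_univ_two, sub_eq_add_neg]

theorem Spoly_cons (c : ℕ) (L : List ℕ) : Spoly (c :: L) = Rpoly L := by
  simp [Rpoly, Spoly, MqNeg, Matrix.mul_apply, Fin.sum_univ_two]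

theorem aeval_qNat_add_three {ω : ℂ} (hω : ω ^ 2 + ω + 1 = 0) (n : ℕ) :
    aeval ω (qNat (n + 3)) = aeval ω (qNat n) := by
  simp only [qNat, Finset.sum_range_succ, map_add, map_pow, aeval_X]
  linear_combination ω ^ n * hω

theorem aeval_qNat_add_three_mul {ω : ℂ} (hω : ω ^ 2 + ω + 1 = 0) (n k : ℕ) :
    aeval ω (qNat (n + 3 * k)) = aeval ω (qNat n) := by
  induction k with
  | zero => rfl
  | succ k ih => rw [← ih, ← aeval_qNat_add_three hω (n + 3 * k)]; rfl

theorem isValuePair_poly {ω : ℂ} (hω : ω ^ 2 + ω + 1 = 0) (L : List ℕ) (hL : ∀ y ∈ L, 2 ≤ y) :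
    IsValuePair ω (aeval ω (Rpoly L)) (aeval ω (Spoly L)) (rNum L) (sNum L) := by
  induction L with
  | nil => exact ⟨1, 1, by simp [IsSignedPow], .inl (by simp [rNum, sNum, Rpoly, Spoly])⟩
  | cons c L ih =>
    have h := ih fun y hy => hL y (List.mem_cons_of_mem _ hy)
    have hc : 2 ≤ c := hL c List.mem_cons_self
    have hpow (k : ℕ) : ω ^ (3 * k) = 1 := by rw [pow_mul, pow_three_eq_one_of_root hω, one_pow]
    have hthree : (3 : ZMod 3) = 0 := rfl
    have hr : rNum (c :: L) = c * rNum L - sNum L := by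
      simp [rNum, sNum, Rpoly_cons, qNat, eval_finsetSum]
    have hs : sNum (c :: L) = rNum L := by simp [rNum, sNum, Spoly_cons]
    rw [hr, hs, Rpoly_cons, Spoly_cons, map_sub, map_mul, map_mul, map_pow, aeval_X]
    push_cast
    obtain ⟨k, rfl | rfl | rfl⟩ : ∃ k, c = 2 + 3 * k ∨ c = 0 + 3 * (k + 1) ∨ c = 1 + 3 * k := by
      rcases (by omega : c % 3 = 2 ∨ c % 3 = 0 ∨ c % 3 = 1) with h | h | h
      · exact ⟨c / 3, by omega⟩
      · exact ⟨c / 3 - 1, by omega⟩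
      · exact ⟨c / 3, by omega⟩
    · have e : 2 + 3 * k - 1 = 1 + 3 * k := by omega
      rw [aeval_qNat_add_three_mul hω, e, pow_add, hpow]
      simpa [qNat, Finset.sum_range_succ, hthree] using h.step_two hω
    · have e : 0 + 3 * (k + 1) - 1 = 2 + 3 * k := by omega
      rw [aeval_qNat_add_three_mul hω, e, pow_add, hpow]
      simpa [qNat, hthree] using h.step_zero hω
    · have e : 1 + 3 * k - 1 = 3 * k := by omega
      rw [aeval_qNat_add_three_mul hω, e, hpow]
      simpa [qNat, hthree] using h.step_one hω

theorem qNat_three_dvd_of_aeval_eq_zero {ω : ℂ} (hω : ω ^ 2 + ω + 1 = 0) {p : ℤ[X]}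
    (hp : aeval ω p = 0) : qNat 3 ∣ p := by
  have hq : qNat 3 = cyclotomic 3 ℤ := by
    rw [cyclotomic_prime]; rfl
  have hroot : IsPrimitiveRoot ω 3 := by
    rw [← isRoot_cyclotomic_iff, cyclotomic_three]
    simpa [IsRoot] using hω
  rw [hq, cyclotomic_eq_minpoly hroot (by norm_num)]
  exact minpoly.isIntegrallyClosed_dvd (hroot.isIntegral (by norm_num)) hp

theorem IsSignedPow.trichotomy {ω z : ℂ} {n : ℤ}
    (h : (z = 0 ∧ (n : ZMod 3) = 0) ∨ IsSignedPow ω z n) :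
    (n ≡ 0 [ZMOD 3] → z = 0) ∧ (n ≡ 1 [ZMOD 3] → z ∈ ({1, ω, ω ^ 2} : Set ℂ)) ∧
      (n ≡ 2 [ZMOD 3] → z ∈ ({-1, -ω, -ω ^ 2} : Set ℂ)) := by
  have h01 : (0 : ZMod 3) ≠ 1 := by decide
  have h02 : (0 : ZMod 3) ≠ 2 := by decide
  have h12 : (1 : ZMod 3) ≠ 2 := by decide
  have hneg : (-1 : ZMod 3) = 2 := by decide
  have key (a : ℤ) : n ≡ a [ZMOD 3] ↔ (n : ZMod 3) = a := (ZMod.intCast_eq_intCast_iff n a 3).symm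
  simp only [key, Set.mem_insert_iff, Set.mem_singleton_iff]
  rcases h with ⟨hz, hn⟩ | ⟨hn, hz⟩ | ⟨hn, hz⟩
  · simp [hn, hz, h01, h02]
  · simp [hn, hz, h12]
  · rw [hneg] at hn
    simp [hn, hz, h02.symm, h12.symm]

theorem IsValuePair.left {ω R S : ℂ} {r s : ZMod 3} (hω : ω ^ 3 = 1)
    (h : IsValuePair ω R S r s) : (R = 0 ∧ r = 0) ∨ IsSignedPow ω R r := by
  obtain ⟨u, e, hu, ⟨rfl, rfl, rfl, rfl⟩ | ⟨rfl, rfl, rfl, rfl⟩ | ⟨rfl, rfl, rfl, rfl⟩ |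
    ⟨rfl, rfl, rfl, rfl⟩⟩ := h
  · exact .inr hu
  · exact .inl ⟨rfl, rfl⟩
  · exact .inr hu
  · exact .inr ((hu.mul_root hω).mul_root hω).neg

theorem IsValuePair.right {ω R S : ℂ} {r s : ZMod 3}
    (h : IsValuePair ω R S r s) : (S = 0 ∧ s = 0) ∨ IsSignedPow ω S s := by
  obtain ⟨u, e, hu, ⟨rfl, rfl, rfl, rfl⟩ | ⟨rfl, rfl, rfl, rfl⟩ | ⟨rfl, rfl, rfl, rfl⟩ |
    ⟨rfl, rfl, rfl, rfl⟩⟩ := h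
  · exact .inl ⟨rfl, rfl⟩
  all_goals exact .inr hu

/-- Values of `𝓢(L)` and `𝓡(L)` at a primitive cube root of unity `ω`, according to the
residues of `s(L)` and `r(L)` mod 3; in particular `[3]_q ∣ 𝓢(L) ↔ 3 ∣ s(L)`. -/
theorem stmt13 (ω : ℂ) (hω : ω ^ 2 + ω + 1 = 0)
    (L : List ℕ) (hL : L ≠ []) (hL2 : ∀ y ∈ L, 2 ≤ y) :
    ((sNum L ≡ 0 [ZMOD 3] → (Polynomial.aeval ω) (Spoly L) = 0) ∧
     (sNum L ≡ 1 [ZMOD 3] → (Polynomial.aeval ω) (Spoly L) ∈ ({1, ω, ω ^ 2} : Set ℂ)) ∧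
     (sNum L ≡ 2 [ZMOD 3] → (Polynomial.aeval ω) (Spoly L) ∈ ({-1, -ω, -ω ^ 2} : Set ℂ)) ∧
     (qNat 3 ∣ Spoly L ↔ (3 : ℤ) ∣ sNum L)) ∧
    ((rNum L ≡ 0 [ZMOD 3] → (Polynomial.aeval ω) (Rpoly L) = 0) ∧
     (rNum L ≡ 1 [ZMOD 3] → (Polynomial.aeval ω) (Rpoly L) ∈ ({1, ω, ω ^ 2} : Set ℂ)) ∧
     (rNum L ≡ 2 [ZMOD 3] → (Polynomial.aeval ω) (Rpoly L) ∈ ({-1, -ω, -ω ^ 2} : Set ℂ))) := by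
  have h := isValuePair_poly hω L hL2
  obtain ⟨hS0, hS1, hS2⟩ := IsSignedPow.trichotomy h.right
  refine ⟨⟨hS0, hS1, hS2, fun hdvd => ?_, fun hdvd => ?_⟩,
    IsSignedPow.trichotomy (h.left (pow_three_eq_one_of_root hω))⟩
  · have := eval_dvd (x := 1) hdvd
    simpa [qNat, eval_finsetSum, sNum] using this
  · exact qNat_three_dvd_of_aeval_eq_zero hω (hS0 (Int.modEq_zero_iff_dvd.2 hdvd))
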